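/- arXiv:1810.05395 — 2 statements merged into one kernel-verified Lean document; each statement's English description precedes it below -/
import Mathlib

section
/- For the formula φ := (p ∧ q) ⊛ (¬p ∧ q) (with ⊛ the nonempty disjunction), the formula φ[p|⊤] ⊗ φ[p|⊥] is not a logical consequence of φ: indeed every team satisfying φ[p|⊤] ⊗ φ[p|⊥] is empty, whereas the nonempty team X = {s₁,s₂} with s₁(p)=s₁(q)=s₂(q)=1 and s₂(p)=0 satisfies φ. In particular φ[p|⊤] ⊗ φ[p|⊥] is not a uniform interpolant of φ with respect to L(φ)∖{p}. -/
/-- Propositional team formulas with the nonempty disjunction `⊛` (`ctens`)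
in addition to literals, `⊤`, `⊥`, `∧` and the team disjunction `⊗`. -/
inductive PForm (V : Type) : Type where
  | top : PForm V
  | var : V → PForm V
  | nvar : V → PForm V
  | bot : PForm V
  | and : PForm V → PForm V → PForm V
  | tens : PForm V → PForm V → PForm V
  | ctens : PForm V → PForm V → PForm V

namespace PForm

variable {V : Type} [DecidableEq V]

/-- Team semantics; `X ⊨ φ ⊛ ψ` iff `X = ∅` or `X = X₁ ∪ X₂` with `X₁, X₂`
nonempty, `X₁ ⊨ φ` and `X₂ ⊨ ψ`. -/
def sat : Set (V → Bool) → PForm V → Prop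
  | _, top => True
  | X, var p => ∀ s ∈ X, s p = true
  | X, nvar p => ∀ s ∈ X, s p = false
  | X, bot => X = ∅
  | X, and φ ψ => sat X φ ∧ sat X ψ
  | X, tens φ ψ => ∃ X₁ X₂, X = X₁ ∪ X₂ ∧ sat X₁ φ ∧ sat X₂ ψ
  | X, ctens φ ψ => X = ∅ ∨
      ∃ X₁ X₂, X₁ ≠ ∅ ∧ X₂ ≠ ∅ ∧ X = X₁ ∪ X₂ ∧ sat X₁ φ ∧ sat X₂ ψ

/-- The set `L(φ)` of letters occurring in `φ`. -/
def letters : PForm V → Set V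
  | top => ∅
  | var p => {p}
  | nvar p => {p}
  | bot => ∅
  | and φ ψ => letters φ ∪ letters ψ
  | tens φ ψ => letters φ ∪ letters ψ
  | ctens φ ψ => letters φ ∪ letters ψ

/-- Syntactic substitution `φ[p|⊤]`. -/
def substTop (p : V) : PForm V → PForm V
  | top => top
  | var q => if q = p then top else var q
  | nvar q => if q = p then bot else nvar q
  | bot => bot
  | and φ ψ => and (substTop p φ) (substTop p ψ)
  | tens φ ψ => tens (substTop p φ) (substTop p ψ)
  | ctens φ ψ => ctens (substTop p φ) (substTop p ψ)

/-- Syntactic substitution `φ[p|⊥]`. -/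
def substBot (p : V) : PForm V → PForm V
  | top => top
  | var q => if q = p then bot else var q
  | nvar q => if q = p then top else nvar q
  | bot => bot
  | and φ ψ => and (substBot p φ) (substBot p ψ)
  | tens φ ψ => tens (substBot p φ) (substBot p ψ)
  | ctens φ ψ => ctens (substBot p φ) (substBot p ψ)

/-- `θ` is a uniform interpolant of `φ` with respect to `L'`. -/
def UnifInterp (φ θ : PForm V) (L' : Set V) : Prop :=
  letters θ ⊆ L' ∧
  (∀ X, sat X φ → sat X θ) ∧
  (∀ ψ : PForm V, (∀ X, sat X φ → sat X ψ) → letters φ ∩ letters ψ ⊆ L' →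
    ∀ X, sat X θ → sat X ψ)

end PForm

open PForm

/-- The example formula `φ := (p ∧ q) ⊛ (¬p ∧ q)` with `p := 0`, `q := 1`. -/
def φex : PForm ℕ := .ctens (.and (.var 0) (.var 1)) (.and (.nvar 0) (.var 1))

/-- `s₁` with `s₁(p) = s₁(q) = 1`. -/
def s₁ : ℕ → Bool := fun _ => true

/-- `s₂` with `s₂(p) = 0`, `s₂(q) = 1`. -/
def s₂ : ℕ → Bool := fun n => if n = 0 then false else true

/-- Only the empty team satisfies `φ[p|⊤] ⊗ φ[p|⊥]`. -/
theorem eq_empty_of_sat_tens_subst {X : Set (ℕ → Bool)}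
    (h : sat X (.tens (substTop 0 φex) (substBot 0 φex))) : X = ∅ := by
  obtain ⟨Y, Z, rfl, hY, hZ⟩ := h
  have hY' : Y = ∅ := by
    rcases hY with hY | ⟨Y₁, Y₂, -, hne, -, -, hbot, -⟩
    · exact hY
    · exact absurd hbot hne
  have hZ' : Z = ∅ := by
    rcases hZ with hZ | ⟨Z₁, Z₂, hne, -, -, ⟨hbot, -⟩, -⟩
    · exact hZ
    · exact absurd hbot hne
  rw [hY', hZ', Set.union_empty]

/-- The team `{s₁, s₂}` satisfies `φ`. -/
theorem sat_pair_φex : sat ({s₁, s₂} : Set (ℕ → Bool)) φex := by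
  refine Or.inr ⟨{s₁}, {s₂}, Set.singleton_ne_empty _, Set.singleton_ne_empty _, rfl, ?_, ?_⟩ <;>
    simp [sat, s₁, s₂]

/-- for `φ := (p ∧ q) ⊛ (¬p ∧ q)`, every team satisfying
`φ[p|⊤] ⊗ φ[p|⊥]` is empty, whereas the nonempty team `{s₁, s₂}` satisfies
`φ`; hence `φ[p|⊤] ⊗ φ[p|⊥]` is not a logical consequence of `φ`, and in
particular it is not a uniform interpolant of `φ` w.r.t. `L(φ) \ {p}`. -/
theorem ctens_counterexample :
    (∀ X : Set (ℕ → Bool), sat X (.tens (substTop 0 φex) (substBot 0 φex)) → X = ∅) ∧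
    ({s₁, s₂} : Set (ℕ → Bool)) ≠ ∅ ∧
    sat ({s₁, s₂} : Set (ℕ → Bool)) φex ∧
    ¬ (∀ X : Set (ℕ → Bool), sat X φex → sat X (.tens (substTop 0 φex) (substBot 0 φex))) ∧
    ¬ UnifInterp φex (.tens (substTop 0 φex) (substBot 0 φex)) (letters φex \ {0}) := by
  have hne : ({s₁, s₂} : Set (ℕ → Bool)) ≠ ∅ := (Set.insert_nonempty _ _).ne_empty
  have hnot : ¬ ∀ X : Set (ℕ → Bool),
      sat X φex → sat X (.tens (substTop 0 φex) (substBot 0 φex)) :=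
    fun h => hne (eq_empty_of_sat_tens_subst (h _ sat_pair_φex))
  exact ⟨fun _ => eq_empty_of_sat_tens_subst, hne, sat_pair_φex, hnot, fun h => hnot h.2.1⟩
end

section
/- The following collections of team model properties are forgetting: (1) the bisimulation invariant, nonempty, downward closed and union closed (flat) properties; (2) the bisimulation invariant, nonempty, downward closed properties; (3) the bisimulation invariant, nonempty, union closed properties. That is, for any property C in one of these collections and any finite set Q of propositions, the property C_{∼Q} = {(N,Y) : ∃(M,X)∈C, (N,Y) ⇌_{Prop∖Q} (M,X)} again belongs to that collection. -/
/-- A Kripke model `M = (W, R, V)` over a set `V` of propositional letters. -/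
structure KModel (V : Type) : Type 1 where
  W : Type
  R : W → W → Prop
  val : W → V → Prop

variable {V : Type}

/-- `B` is a `P`-bisimulation between the Kripke models `M` and `N`:
related points agree on all propositions of `P`, and `B` satisfies the
forth and back conditions. -/
def IsBisim (P : Set V) (M N : KModel V) (B : M.W → N.W → Prop) : Prop :=
  (∀ w v, B w v → ∀ p ∈ P, (M.val w p ↔ N.val v p)) ∧
  (∀ w v, B w v → ∀ w', M.R w w' → ∃ v', N.R v v' ∧ B w' v') ∧
  (∀ w v, B w v → ∀ v', N.R v v' → ∃ w', M.R w w' ∧ B w' v')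

/-- `(M,w) ⇌_P (N,v)`: some `P`-bisimulation relates `w` and `v`. -/
def Bisimilar (P : Set V) (M : KModel V) (w : M.W) (N : KModel V) (v : N.W) : Prop :=
  ∃ B, IsBisim P M N B ∧ B w v

/-- Team `P`-bisimulation `(M,X) ⇌_P (N,Y)`: every point of `X` is
`P`-bisimilar to some point of `Y` and conversely. -/
def TeamBisim (P : Set V) (M : KModel V) (X : Set M.W) (N : KModel V) (Y : Set N.W) : Prop :=
  (∀ x ∈ X, ∃ y ∈ Y, Bisimilar P M x N y) ∧
  (∀ y ∈ Y, ∃ x ∈ X, Bisimilar P M x N y)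

/-- A team model property: a class of team models `(M,X)`. -/
def TeamProp (V : Type) : Type 1 := (M : KModel V) → Set M.W → Prop

/-- `C` is bisimulation invariant (w.r.t. all letters). -/
def BisimInvariant (C : TeamProp V) : Prop :=
  ∀ (M N : KModel V) (X : Set M.W) (Y : Set N.W),
    C M X → TeamBisim (Set.univ : Set V) M X N Y → C N Y

/-- `C` is nonempty. -/
def NonemptyProp (C : TeamProp V) : Prop :=
  ∃ (M : KModel V) (X : Set M.W), C M X

/-- `C` is downward closed. -/
def DownClosed (C : TeamProp V) : Prop :=
  ∀ (M : KModel V) (X Y : Set M.W), C M X → Y ⊆ X → C M Y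

/-- `C` is union closed. -/
def UnionClosed (C : TeamProp V) : Prop :=
  ∀ (M : KModel V) (X₁ X₂ : Set M.W), C M X₁ → C M X₂ → C M (X₁ ∪ X₂)

/-- `C_{∼Q}`: the team models in `C` modulo bisimulation forgetting the
letters of `Q` (the set `Prop` of all letters being the whole type `V`). -/
def forget (C : TeamProp V) (Q : Set V) : TeamProp V :=
  fun N Y => ∃ (M : KModel V) (X : Set M.W),
    C M X ∧ TeamBisim (Set.univ \ Q) N Y M X

theorem IsBisim.mono {P P' : Set V} (h : P' ⊆ P) {M N : KModel V} {B : M.W → N.W → Prop}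
    (hB : IsBisim P M N B) : IsBisim P' M N B :=
  ⟨fun w v hwv p hp => hB.1 w v hwv p (h hp), hB.2⟩

theorem Bisimilar.mono {P P' : Set V} (h : P' ⊆ P) {M N : KModel V} {w : M.W} {v : N.W}
    (hwv : Bisimilar P M w N v) : Bisimilar P' M w N v :=
  let ⟨B, hB, hb⟩ := hwv
  ⟨B, hB.mono h, hb⟩

theorem Bisimilar.refl (P : Set V) (M : KModel V) (w : M.W) : Bisimilar P M w M w := by
  refine ⟨Eq, ⟨?_, ?_, ?_⟩, rfl⟩
  · rintro w _ rfl p _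
    rfl
  · rintro w _ rfl w' h
    exact ⟨w', h, rfl⟩
  · rintro w _ rfl w' h
    exact ⟨w', h, rfl⟩

theorem Bisimilar.symm {P : Set V} {M N : KModel V} {w : M.W} {v : N.W}
    (h : Bisimilar P M w N v) : Bisimilar P N v M w := by
  obtain ⟨B, ⟨h1, h2, h3⟩, hb⟩ := h
  exact ⟨fun v w => B w v, ⟨fun v w hB p hp => (h1 w v hB p hp).symm,
    fun v w hB => h3 w v hB, fun v w hB => h2 w v hB⟩, hb⟩

theorem Bisimilar.trans {P : Set V} {M N K : KModel V} {w : M.W} {v : N.W} {u : K.W}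
    (h : Bisimilar P M w N v) (h' : Bisimilar P N v K u) : Bisimilar P M w K u := by
  obtain ⟨B, ⟨h1, h2, h3⟩, hb⟩ := h
  obtain ⟨B', ⟨h1', h2', h3'⟩, hb'⟩ := h'
  refine ⟨fun w u => ∃ v, B w v ∧ B' v u, ⟨?_, ?_, ?_⟩, v, hb, hb'⟩
  · rintro w u ⟨v, hB, hB'⟩ p hp
    exact (h1 w v hB p hp).trans (h1' v u hB' p hp)
  · rintro w u ⟨v, hB, hB'⟩ w' hw
    obtain ⟨v', hv, hb⟩ := h2 w v hB w' hw
    obtain ⟨u', hu, hb'⟩ := h2' v u hB' v' hv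
    exact ⟨u', hu, v', hb, hb'⟩
  · rintro w u ⟨v, hB, hB'⟩ u' hu
    obtain ⟨v', hv, hb'⟩ := h3' v u hB' u' hu
    obtain ⟨w', hw, hb⟩ := h3 w v hB v' hv
    exact ⟨w', hw, v', hb, hb'⟩

theorem TeamBisim.mono {P P' : Set V} (h : P' ⊆ P) {M N : KModel V} {X : Set M.W} {Y : Set N.W}
    (hXY : TeamBisim P M X N Y) : TeamBisim P' M X N Y :=
  ⟨fun x hx => let ⟨y, hy, hb⟩ := hXY.1 x hx; ⟨y, hy, hb.mono h⟩,
    fun y hy => let ⟨x, hx, hb⟩ := hXY.2 y hy; ⟨x, hx, hb.mono h⟩⟩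

theorem TeamBisim.refl (P : Set V) (M : KModel V) (X : Set M.W) : TeamBisim P M X M X :=
  ⟨fun x hx => ⟨x, hx, .refl P M x⟩, fun x hx => ⟨x, hx, .refl P M x⟩⟩

theorem TeamBisim.symm {P : Set V} {M N : KModel V} {X : Set M.W} {Y : Set N.W}
    (h : TeamBisim P M X N Y) : TeamBisim P N Y M X :=
  ⟨fun y hy => let ⟨x, hx, hb⟩ := h.2 y hy; ⟨x, hx, hb.symm⟩,
    fun x hx => let ⟨y, hy, hb⟩ := h.1 x hx; ⟨y, hy, hb.symm⟩⟩

theorem TeamBisim.trans {P : Set V} {M N K : KModel V} {X : Set M.W} {Y : Set N.W} {Z : Set K.W}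
    (h : TeamBisim P M X N Y) (h' : TeamBisim P N Y K Z) : TeamBisim P M X K Z := by
  refine ⟨fun x hx => ?_, fun z hz => ?_⟩
  · obtain ⟨y, hy, hb⟩ := h.1 x hx
    obtain ⟨z, hz, hb'⟩ := h'.1 y hy
    exact ⟨z, hz, hb.trans hb'⟩
  · obtain ⟨y, hy, hb'⟩ := h'.2 z hz
    obtain ⟨x, hx, hb⟩ := h.2 y hy
    exact ⟨x, hx, hb.trans hb'⟩

theorem TeamBisim.union {P : Set V} {M N : KModel V} {X₁ X₂ : Set M.W} {Y₁ Y₂ : Set N.W}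
    (h₁ : TeamBisim P M X₁ N Y₁) (h₂ : TeamBisim P M X₂ N Y₂) :
    TeamBisim P M (X₁ ∪ X₂) N (Y₁ ∪ Y₂) := by
  constructor
  · rintro x (hx | hx)
    · obtain ⟨y, hy, hb⟩ := h₁.1 x hx
      exact ⟨y, .inl hy, hb⟩
    · obtain ⟨y, hy, hb⟩ := h₂.1 x hx
      exact ⟨y, .inr hy, hb⟩
  · rintro y (hy | hy)
    · obtain ⟨x, hx, hb⟩ := h₁.2 y hy
      exact ⟨x, .inl hx, hb⟩
    · obtain ⟨x, hx, hb⟩ := h₂.2 y hy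
      exact ⟨x, .inr hx, hb⟩

/-- The disjoint union of two Kripke models. -/
def KModel.sum (M N : KModel V) : KModel V where
  W := M.W ⊕ N.W
  R := Sum.LiftRel M.R N.R
  val := Sum.elim M.val N.val

theorem Bisimilar.sum_inl (P : Set V) (M N : KModel V) (w : M.W) :
    Bisimilar P M w (M.sum N) (Sum.inl w) := by
  refine ⟨fun w v => v = Sum.inl w, ⟨?_, ?_, ?_⟩, rfl⟩
  · rintro w _ rfl p _
    rfl
  · rintro w _ rfl w' h
    exact ⟨_, Sum.LiftRel.inl h, rfl⟩
  · rintro w _ rfl _ (h | h)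
    exact ⟨_, h, rfl⟩

theorem Bisimilar.sum_inr (P : Set V) (M N : KModel V) (w : N.W) :
    Bisimilar P N w (M.sum N) (Sum.inr w) := by
  refine ⟨fun w v => v = Sum.inr w, ⟨?_, ?_, ?_⟩, rfl⟩
  · rintro w _ rfl p _
    rfl
  · rintro w _ rfl w' h
    exact ⟨_, Sum.LiftRel.inr h, rfl⟩
  · rintro w _ rfl _ (h | h)
    exact ⟨_, h, rfl⟩

theorem TeamBisim.image {P : Set V} {M N : KModel V} {f : M.W → N.W}
    (hf : ∀ w, Bisimilar P M w N (f w)) (X : Set M.W) : TeamBisim P M X N (f '' X) := by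
  refine ⟨fun x hx => ⟨f x, ⟨x, hx, rfl⟩, hf x⟩, ?_⟩
  rintro _ ⟨x, hx, rfl⟩
  exact ⟨x, hx, hf x⟩

theorem bisimInvariant_forget (C : TeamProp V) (Q : Set V) : BisimInvariant (forget C Q) := by
  rintro N K Y Z ⟨M, X, hC, hYX⟩ hYZ
  exact ⟨M, X, hC, (hYZ.mono (Set.subset_univ _)).symm.trans hYX⟩

theorem NonemptyProp.forget {C : TeamProp V} (hC : NonemptyProp C) (Q : Set V) :
    NonemptyProp (forget C Q) :=
  let ⟨M, X, h⟩ := hC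
  ⟨M, X, M, X, h, .refl _ M X⟩

theorem DownClosed.forget {C : TeamProp V} (hC : DownClosed C) (Q : Set V) :
    DownClosed (forget C Q) := by
  rintro N Y Y' ⟨M, X, h, hYX⟩ hY'
  refine ⟨M, {x ∈ X | ∃ y ∈ Y', Bisimilar (Set.univ \ Q) N y M x},
    hC M X _ h (Set.sep_subset _ _), fun y hy => ?_, fun x hx => hx.2⟩
  obtain ⟨x, hx, hb⟩ := hYX.1 y (hY' hy)
  exact ⟨x, ⟨hx, y, hy, hb⟩, hb⟩

theorem UnionClosed.forget {C : TeamProp V} (hC : UnionClosed C) (hinv : BisimInvariant C)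
    (Q : Set V) : UnionClosed (forget C Q) := by
  rintro N Y₁ Y₂ ⟨M₁, X₁, h₁, hb₁⟩ ⟨M₂, X₂, h₂, hb₂⟩
  have hl := fun P => TeamBisim.image (Bisimilar.sum_inl P M₁ M₂) X₁
  have hr := fun P => TeamBisim.image (Bisimilar.sum_inr P M₁ M₂) X₂
  exact ⟨M₁.sum M₂, _, hC _ _ _ (hinv _ _ _ _ h₁ (hl _)) (hinv _ _ _ _ h₂ (hr _)),
    (hb₁.trans (hl _)).union (hb₂.trans (hr _))⟩

/-- the collections of (1) bisimulation invariant, nonempty,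
downward and union closed ("flat"); (2) bisimulation invariant, nonempty,
downward closed; (3) bisimulation invariant, nonempty, union closed team
model properties are all forgetting: each is closed under `C ↦ C_{∼Q}`
for finite `Q`. -/
theorem forgetting_collections {V : Type} :
    (∀ (C : TeamProp V) (Q : Set V), Q.Finite →
      BisimInvariant C → NonemptyProp C → DownClosed C → UnionClosed C →
        BisimInvariant (forget C Q) ∧ NonemptyProp (forget C Q) ∧
          DownClosed (forget C Q) ∧ UnionClosed (forget C Q)) ∧
    (∀ (C : TeamProp V) (Q : Set V), Q.Finite →
      BisimInvariant C → NonemptyProp C → DownClosed C →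
        BisimInvariant (forget C Q) ∧ NonemptyProp (forget C Q) ∧
          DownClosed (forget C Q)) ∧
    (∀ (C : TeamProp V) (Q : Set V), Q.Finite →
      BisimInvariant C → NonemptyProp C → UnionClosed C →
        BisimInvariant (forget C Q) ∧ NonemptyProp (forget C Q) ∧
          UnionClosed (forget C Q)) := by
  exact ⟨fun C Q _ hinv hne hd hu =>
      ⟨bisimInvariant_forget C Q, hne.forget Q, hd.forget Q, hu.forget hinv Q⟩,
    fun C Q _ _ hne hd => ⟨bisimInvariant_forget C Q, hne.forget Q, hd.forget Q⟩,
    fun C Q _ hinv hne hu => ⟨bisimInvariant_forget C Q, hne.forget Q, hu.forget hinv Q⟩⟩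
end
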